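/- Let n ≥ 2, r ≥ 2 with r-1 dividing n-1, and set t = (n-1)/(r-1). Let x = (x_1,...,x_n) be positive integers with sum equal to rt. Then the number of r-uniform hypertrees on [n] in which vertex i has degree x_i equals (r-1)·(n-2)! / ( ((r-1)!)^t · ∏_{i=1}^n (x_i - 1)! ). -/

import Mathlib

open Finset

/-- A Berge path of positive length exists between any two distinct vertices. -/
def BergeConnected {V : Type*} [DecidableEq V] (E : Finset (Finset V)) : Prop :=
  ∀ u v : V, u ≠ v → ∃ (ℓ : ℕ) (vs : Fin (ℓ + 1) → V) (es : Fin ℓ → Finset V),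
    Function.Injective vs ∧ Function.Injective es ∧ (∀ i, es i ∈ E) ∧
    vs 0 = u ∧ vs (Fin.last ℓ) = v ∧
    ∀ i : Fin ℓ, vs i.castSucc ∈ es i ∧ vs i.succ ∈ es i

/-- A 2-cycle: two distinct edges sharing at least two vertices. -/
def HasTwoCycle {V : Type*} [DecidableEq V] (E : Finset (Finset V)) : Prop :=
  ∃ e ∈ E, ∃ f ∈ E, e ≠ f ∧ 2 ≤ (e ∩ f).card

/-- A cycle of length ℓ ≥ 3: distinct edges e₁,…,e_ℓ and distinct vertices
v₁,…,v_ℓ with vᵢ ∈ eᵢ ∩ eᵢ₊₁ (cyclically). -/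
def HasLongCycle {V : Type*} [DecidableEq V] (E : Finset (Finset V)) : Prop :=
  ∃ (ℓ : ℕ) (es : Fin (ℓ + 3) → Finset V) (vs : Fin (ℓ + 3) → V),
    Function.Injective es ∧ Function.Injective vs ∧ (∀ i, es i ∈ E) ∧
    ∀ i, vs i ∈ es i ∧ vs i ∈ es (i + 1)

/-- A hypertree is a connected hypergraph with no cycles (edges are sets, so
there are no loops/1-cycles). -/
def IsHypertree {V : Type*} [DecidableEq V] (E : Finset (Finset V)) : Prop :=
  BergeConnected E ∧ ¬ HasTwoCycle E ∧ ¬ HasLongCycle E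

/-- `r`-uniform: every edge has exactly `r` vertices. -/
def UniformR {V : Type*} (r : ℕ) (E : Finset (Finset V)) : Prop :=
  ∀ e ∈ E, e.card = r

/-- Degree of a vertex: number of edges containing it. -/
def hdegree {V : Type*} [DecidableEq V] (E : Finset (Finset V)) (v : V) : ℕ :=
  (E.filter (fun e => v ∈ e)).card

section BipartiteTrees

variable {α β : Type*}

/-- The bipartite graph with parts `A`, `B` and edges `R` is connected: every two-colouring of the
vertices that is constant along edges is constant. -/
def IncConnected (A : Finset α) (B : Finset β) (R : Finset (α × β)) : Prop :=
  ∀ (c : α → Prop) (d : β → Prop), (∀ p ∈ R, c p.1 ↔ d p.2) →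
    ∃ q : Prop, (∀ a ∈ A, c a ↔ q) ∧ ∀ b ∈ B, d b ↔ q

open Classical in
/-- Connected bipartite graphs with parts `A`, `B` and prescribed degrees `x`, `y`. -/
noncomputable def connBip (A : Finset α) (B : Finset β) (x : α → ℕ) (y : β → ℕ) :
    Finset (Finset (α × β)) :=
  (A ×ˢ B).powerset.filter fun R =>
    IncConnected A B R ∧ (∀ a ∈ A, #{p ∈ R | p.1 = a} = x a) ∧
      ∀ b ∈ B, #{p ∈ R | p.2 = b} = y b

open Classical in
theorem mem_connBip {A : Finset α} {B : Finset β} {x : α → ℕ} {y : β → ℕ}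
    {R : Finset (α × β)} :
    R ∈ connBip A B x y ↔ (∀ p ∈ R, p.1 ∈ A ∧ p.2 ∈ B) ∧ IncConnected A B R ∧
      (∀ a ∈ A, #{p ∈ R | p.1 = a} = x a) ∧ ∀ b ∈ B, #{p ∈ R | p.2 = b} = y b := by
  simp only [connBip, mem_filter, mem_powerset, Finset.subset_iff, mem_product]

open Classical in
theorem card_connBip_le_swap (A : Finset α) (B : Finset β) (x : α → ℕ) (y : β → ℕ) :
    #(connBip A B x y) ≤ #(connBip B A y x) := by
  refine Finset.card_le_card_of_injOn
    (fun R => R.map (Equiv.prodComm α β).toEmbedding) ?_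
    (fun R _ S _ h => Finset.map_injective _ h)
  intro R hR
  rw [mem_coe, mem_connBip] at hR
  obtain ⟨h1, h2, h3, h4⟩ := hR
  rw [mem_coe, mem_connBip]
  refine ⟨?_, ?_, ?_, ?_⟩
  · rintro ⟨b, a⟩ h
    have : (a, b) ∈ R := by simpa using h
    exact (h1 _ this).symm
  · intro c d h
    obtain ⟨q, hA, hB⟩ := h2 d c (fun p hp => (h (p.2, p.1) (by simpa using hp)).symm)
    exact ⟨q, hB, hA⟩
  · intro b hb
    rw [← h4 b hb, Finset.filter_map, Finset.card_map]
    rfl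
  · intro a ha
    rw [← h3 a ha, Finset.filter_map, Finset.card_map]
    rfl

theorem card_connBip_swap (A : Finset α) (B : Finset β) (x : α → ℕ) (y : β → ℕ) :
    #(connBip A B x y) = #(connBip B A y x) :=
  le_antisymm (card_connBip_le_swap A B x y) (card_connBip_le_swap B A y x)

theorem connBip_eq_empty {A : Finset α} {B : Finset β} {x : α → ℕ} {y : β → ℕ}
    (hA : A.Nonempty) {b : β} (hb : b ∈ B) (hy : y b = 0) : connBip A B x y = ∅ := by
  classical
  refine Finset.eq_empty_of_forall_notMem fun R hR => ?_
  obtain ⟨-, h2, -, h4⟩ := mem_connBip.1 hR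
  obtain ⟨a, ha⟩ := hA
  have hcard := h4 b hb
  rw [hy, Finset.card_eq_zero, Finset.filter_eq_empty_iff] at hcard
  obtain ⟨q, hqA, hqB⟩ := h2 (fun _ => False) (fun b' => b' = b)
    (fun p hp => by simpa using hcard hp)
  have := (hqA a ha).trans (hqB b hb).symm
  simp at this

theorem IncConnected.insert_leaf [DecidableEq α] [DecidableEq β] {A : Finset α} {B : Finset β}
    {R : Finset (α × β)} {a : α} {b : β}
    (hb : b ∈ B) (h : IncConnected (A.erase a) B R) : IncConnected A B (insert (a, b) R) := by
  intro c d hcd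
  obtain ⟨q, hqA, hqB⟩ := h c d fun p hp => hcd p (mem_insert_of_mem hp)
  refine ⟨q, fun a' ha' => ?_, hqB⟩
  by_cases h' : a' = a
  · subst h'
    exact (hcd _ (mem_insert_self _ _)).trans (hqB b hb)
  · exact hqA a' (mem_erase.2 ⟨h', ha'⟩)

theorem IncConnected.erase_leaf [DecidableEq α] [DecidableEq β] {A : Finset α} {B : Finset β}
    {R : Finset (α × β)} {a : α} {b : β}
    (hR : ∀ p ∈ R, p.1 ≠ a)
    (h : IncConnected A B (insert (a, b) R)) : IncConnected (A.erase a) B R := by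
  intro c d hcd
  obtain ⟨q, hqA, hqB⟩ := h (fun a' => if a' = a then d b else c a') d fun p hp => by
    rcases mem_insert.1 hp with rfl | hp
    · simp
    · simp [hR p hp, hcd p hp]
  refine ⟨q, fun a' ha' => ?_, hqB⟩
  have := hqA a' (mem_of_mem_erase ha')
  simpa [ne_of_mem_erase ha'] using this

open Classical in
/-- Deleting a leaf `a` of a connected bipartite graph. -/
theorem card_connBip_eq_sum {A : Finset α} {B : Finset β}
    {x : α → ℕ} {y : β → ℕ}
    {a : α} (ha : a ∈ A) (hxa : x a = 1) (hy : ∀ b ∈ B, 1 ≤ y b) :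
    #(connBip A B x y) =
      ∑ b ∈ B, #(connBip (A.erase a) B x (Function.update y b (y b - 1))) := by
  rw [← Finset.card_sigma]
  symm
  refine Finset.card_bij (fun s _ => insert (a, s.1) s.2) ?_ ?_ ?_
  · rintro ⟨b, R⟩ hs
    obtain ⟨hb, hR⟩ := mem_sigma.1 hs
    dsimp only at hb hR ⊢
    have hne : ∀ p ∈ R, p.1 ≠ a := fun p hp => ne_of_mem_erase ((mem_connBip.1 hR).1 p hp).1
    have hnot : (a, b) ∉ R := fun h => hne _ h rfl
    obtain ⟨h1, h2, h3, h4⟩ := mem_connBip.1 hR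
    refine mem_connBip.2 ⟨?_, h2.insert_leaf hb, ?_, ?_⟩
    · intro p hp
      rcases mem_insert.1 hp with rfl | hp
      · exact ⟨ha, hb⟩
      · exact ⟨mem_of_mem_erase (h1 p hp).1, (h1 p hp).2⟩
    · intro a' ha'
      rw [filter_insert]
      by_cases h' : a' = a
      · subst h'
        rw [if_pos rfl, hxa, Finset.filter_eq_empty_iff.2 (fun {p} hp => hne p hp)]
        simp
      · rw [if_neg (Ne.symm h'), h3 a' (mem_erase.2 ⟨h', ha'⟩)]
    · intro b' hb'
      rw [filter_insert]
      have h4' := h4 b' hb'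
      by_cases h' : b' = b
      · subst h'
        rw [if_pos rfl, card_insert_of_notMem (by simp [hnot]), h4', Function.update_self]
        have := hy b' hb
        omega
      · rw [if_neg (Ne.symm h'), h4', Function.update_of_ne h']
  · rintro ⟨b, R⟩ hs ⟨b', R'⟩ hs' heq
    dsimp only at heq
    have hne : ∀ p ∈ R, p.1 ≠ a :=
      fun p hp => ne_of_mem_erase ((mem_connBip.1 (mem_sigma.1 hs).2).1 p hp).1
    have hne' : ∀ p ∈ R', p.1 ≠ a :=
      fun p hp => ne_of_mem_erase ((mem_connBip.1 (mem_sigma.1 hs').2).1 p hp).1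
    have hbb : b = b' := by
      have : (a, b) ∈ insert (a, b') R' := heq ▸ mem_insert_self _ _
      rcases mem_insert.1 this with h | h
      · exact (Prod.ext_iff.1 h).2
      · exact absurd rfl (hne' _ h)
    subst hbb
    have hRR : R = R' := by
      rw [← erase_insert (fun h => hne _ h rfl : (a, b) ∉ R), heq,
        erase_insert (fun h => hne' _ h rfl : (a, b) ∉ R')]
    rw [hRR]
  · intro R hR
    obtain ⟨h1, h2, h3, h4⟩ := mem_connBip.1 hR
    obtain ⟨⟨a', b⟩, hab⟩ := Finset.card_eq_one.1 ((h3 a ha).trans hxa)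
    have hmem : (a', b) ∈ R ∧ a' = a := by
      have : (a', b) ∈ ({p ∈ R | p.1 = a} : Finset _) := hab ▸ mem_singleton_self _
      simpa using this
    obtain ⟨hmem, rfl⟩ := hmem
    have hne : ∀ p ∈ R.erase (a', b), p.1 ≠ a' := by
      intro p hp hpa
      have : p ∈ ({p ∈ R | p.1 = a'} : Finset _) := mem_filter.2 ⟨mem_of_mem_erase hp, hpa⟩
      rw [hab, mem_singleton] at this
      exact ne_of_mem_erase hp this
    refine ⟨⟨b, R.erase (a', b)⟩, ?_, insert_erase hmem⟩
    refine mem_sigma.2 ⟨(h1 _ hmem).2, mem_connBip.2 ⟨?_, ?_, ?_, ?_⟩⟩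
    · intro p hp
      have := h1 p (mem_of_mem_erase hp)
      exact ⟨mem_erase.2 ⟨hne p hp, this.1⟩, this.2⟩
    · refine IncConnected.erase_leaf hne (b := b) ?_
      rwa [insert_erase hmem]
    · intro a'' ha''
      rw [← h3 a'' (mem_of_mem_erase ha''), filter_erase, erase_eq_of_notMem]
      simp [(ne_of_mem_erase ha'').symm]
    · intro b' hb'
      by_cases h' : b' = b
      · subst h'
        rw [filter_erase, card_erase_of_mem (by simp [hmem]), h4 b' hb']
        simp
      · dsimp only
        rw [Function.update_of_ne h', ← h4 b' hb', filter_erase, erase_eq_of_notMem]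
        simp [Ne.symm h']

theorem card_connBip_singleton {a : α} {b : β} {x : α → ℕ} {y : β → ℕ}
    (hx : x a = 1) (hy : y b = 1) : #(connBip {a} {b} x y) = 1 := by
  classical
  rw [Finset.card_eq_one]
  refine ⟨{(a, b)}, Finset.ext fun R => ?_⟩
  rw [mem_singleton]
  constructor
  · intro hR
    obtain ⟨h1, -, h3, -⟩ := mem_connBip.1 hR
    have hsub : ∀ p ∈ R, p = (a, b) := fun p hp => by
      have := h1 p hp
      simp only [mem_singleton] at this
      exact Prod.ext this.1 this.2
    have hc := h3 a (mem_singleton_self a)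
    rw [hx] at hc
    refine (Finset.subset_singleton_iff.1 fun p hp => mem_singleton.2 (hsub p hp)).resolve_left ?_
    rintro rfl
    simp at hc
  · rintro rfl
    refine mem_connBip.2 ⟨by simp, ?_, by simp [filter_singleton, hx],
      by simp [filter_singleton, hy]⟩
    intro c d h
    refine ⟨d b, ?_, by simp⟩
    simpa using h

theorem prod_factorial_update [DecidableEq β] {B : Finset β} {y : β → ℕ} {b : β} (hb : b ∈ B)
    (hy : 2 ≤ y b) :
    ∏ i ∈ B, (y i - 1).factorial =
      (y b - 1) * ∏ i ∈ B, (Function.update y b (y b - 1) i - 1).factorial := by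
  rw [← Finset.mul_prod_erase B _ hb, ← Finset.mul_prod_erase B (fun i =>
    (Function.update y b (y b - 1) i - 1).factorial) hb, Function.update_self, ← mul_assoc,
    Nat.mul_factorial_pred (by omega)]
  congr 1
  refine Finset.prod_congr rfl fun i hi => ?_
  rw [Function.update_of_ne (ne_of_mem_erase hi)]

theorem sum_update_pred [DecidableEq β] {B : Finset β} {y : β → ℕ} {b : β} (hb : b ∈ B)
    (hy : 1 ≤ y b) :
    ∑ i ∈ B, Function.update y b (y b - 1) i + 1 = ∑ i ∈ B, y i := by
  rw [← Finset.add_sum_erase B _ hb, ← Finset.add_sum_erase B y hb, Function.update_self,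
    Finset.sum_congr rfl fun i hi => Function.update_of_ne (ne_of_mem_erase hi) _ _]
  omega

theorem exists_eq_one_of_sum_lt {A : Finset α} {x : α → ℕ} (hx : ∀ a ∈ A, 1 ≤ x a)
    (h : ∑ a ∈ A, x a < 2 * #A) : ∃ a ∈ A, x a = 1 := by
  by_contra! hcon
  have : ∑ a ∈ A, 2 ≤ ∑ a ∈ A, x a := Finset.sum_le_sum fun a ha => by
    have := hx a ha
    have := hcon a ha
    omega
  rw [Finset.sum_const, smul_eq_mul] at this
  omega

/-- The leaf-deletion step in the count of bipartite trees with given degrees. -/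
theorem card_connBip_mul_of_leaf {A : Finset α} {B : Finset β} {x : α → ℕ} {y : β → ℕ}
    (hA : 2 ≤ #A) (hy : ∀ b ∈ B, 1 ≤ y b)
    (hsx : ∑ a ∈ A, x a + 1 = #A + #B) (hsy : ∑ b ∈ B, y b + 1 = #A + #B)
    {a : α} (ha : a ∈ A) (hxa : x a = 1)
    (ih : ∀ (A' : Finset α) (y' : β → ℕ), A' ⊆ A → #A' + 1 = #A → (∀ b ∈ B, 1 ≤ y' b) →
      ∑ a ∈ A', x a + 1 = #A' + #B → ∑ b ∈ B, y' b + 1 = #A' + #B →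
      #(connBip A' B x y') * ((∏ a ∈ A', (x a - 1).factorial) * ∏ b ∈ B, (y' b - 1).factorial) =
        (#A' - 1).factorial * (#B - 1).factorial) :
    #(connBip A B x y) * ((∏ a ∈ A, (x a - 1).factorial) * ∏ b ∈ B, (y b - 1).factorial) =
        (#A - 1).factorial * (#B - 1).factorial := by
  classical
  have hcard : #(A.erase a) = #A - 1 := card_erase_of_mem ha
  have hAe : (A.erase a).Nonempty := card_pos.1 (by omega)
  have hterm : ∀ b ∈ B, #(connBip (A.erase a) B x (Function.update y b (y b - 1))) *
      ((∏ a ∈ A, (x a - 1).factorial) * ∏ b ∈ B, (y b - 1).factorial) =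
      (y b - 1) * ((#A - 2).factorial * (#B - 1).factorial) := by
    intro b hb
    have hyb := hy b hb
    rcases hyb.eq_or_lt with h1 | h2
    · rw [connBip_eq_empty hAe hb (by simp [← h1]), ← h1]
      simp
    · rw [prod_factorial_update hb h2, ← Finset.mul_prod_erase A _ ha, hxa]
      have hS := Finset.add_sum_erase A x ha
      have hU := sum_update_pred hb hyb
      have := ih (A.erase a) (Function.update y b (y b - 1)) (erase_subset _ _) (by omega)
        (fun i hi => by
          by_cases h' : i = b
          · subst h'
            rw [Function.update_self]
            omega
          · rw [Function.update_of_ne h']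
            exact hy i hi) (by omega) (by omega)
      rw [hcard, Nat.sub_sub] at this
      rw [← this]
      simp only [Nat.sub_self, Nat.factorial_zero, one_mul]
      ring
  rw [card_connBip_eq_sum ha hxa hy, Finset.sum_mul, Finset.sum_congr rfl hterm, ← Finset.sum_mul]
  have hsum : ∑ b ∈ B, (y b - 1) + #B = ∑ b ∈ B, y b := by
    rw [Finset.card_eq_sum_ones, ← Finset.sum_add_distrib]
    exact Finset.sum_congr rfl fun b hb => Nat.sub_add_cancel (hy b hb)
  have h1 : ∑ b ∈ B, (y b - 1) = #A - 1 := by omega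
  rw [h1, ← mul_assoc, ← Nat.mul_factorial_pred (n := #A - 1) (by omega), Nat.sub_sub]

/-- The number of bipartite trees with prescribed degrees. -/
theorem card_connBip_mul {A : Finset α} {B : Finset β} {x : α → ℕ} {y : β → ℕ}
    (hA : A.Nonempty) (hB : B.Nonempty) (hx : ∀ a ∈ A, 1 ≤ x a) (hy : ∀ b ∈ B, 1 ≤ y b)
    (hsx : ∑ a ∈ A, x a + 1 = #A + #B) (hsy : ∑ b ∈ B, y b + 1 = #A + #B) :
    #(connBip A B x y) * ((∏ a ∈ A, (x a - 1).factorial) * ∏ b ∈ B, (y b - 1).factorial) =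
        (#A - 1).factorial * (#B - 1).factorial := by
  induction hN : #A + #B using Nat.strong_induction_on generalizing A B x y with
  | _ N ih =>
  subst hN
  have hA' := hA.card_pos
  have hB' := hB.card_pos
  by_cases hleaf : 2 ≤ #A ∧ ∃ a ∈ A, x a = 1
  · obtain ⟨hA2, a, ha, hxa⟩ := hleaf
    refine card_connBip_mul_of_leaf hA2 hy hsx hsy ha hxa ?_
    intro A' y' hsub hc hy' h1 h2
    exact ih _ (by omega) (card_pos.1 (by omega)) hB (fun a ha => hx a (hsub ha)) hy' h1 h2 rfl
  by_cases hB2 : 2 ≤ #B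
  · obtain ⟨b, hb, hyb⟩ : ∃ b ∈ B, y b = 1 := by
      refine exists_eq_one_of_sum_lt hy ?_
      by_contra! hcon
      exact hleaf ⟨by omega, exists_eq_one_of_sum_lt hx (by omega)⟩
    rw [card_connBip_swap, mul_comm (∏ a ∈ A, _), mul_comm (#A - 1).factorial]
    refine card_connBip_mul_of_leaf hB2 hx (by omega) (by omega) hb hyb ?_
    intro B' x' hsub hc hx' h1 h2
    rw [card_connBip_swap, mul_comm (∏ b ∈ B', _), mul_comm (#B' - 1).factorial]
    exact ih _ (by omega) hA (card_pos.1 (by omega)) hx' (fun b hb => hy b (hsub hb))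
      (by omega) (by omega) rfl
  · have hB1 : #B = 1 := by omega
    have hA1 : #A = 1 := by
      by_contra h
      exact hleaf ⟨by omega, exists_eq_one_of_sum_lt hx (by omega)⟩
    obtain ⟨a, rfl⟩ := card_eq_one.1 hA1
    obtain ⟨b, rfl⟩ := card_eq_one.1 hB1
    simp only [sum_singleton, card_singleton] at hsx hsy
    rw [card_connBip_singleton (by omega) (by omega)]
    have h1 : x a = 1 := by omega
    have h2 : y b = 1 := by omega
    simp [h1, h2]

end BipartiteTrees

section Incidences

variable {V ι : Type*} [Fintype V] [Fintype ι]

/-- A connected bipartite graph has at least `|V| - 1` edges. -/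
theorem IncConnected.card_le [Nonempty V] {R : Finset (V × ι)} (h : IncConnected univ univ R) :
    Fintype.card V + Fintype.card ι ≤ #R + 1 := by
  obtain ⟨v₀⟩ := ‹Nonempty V›
  let L : ((V → ℚ) × (ι → ℚ)) →ₗ[ℚ] (R → ℚ) × ℚ :=
    LinearMap.prod
      (LinearMap.pi fun p =>
        (LinearMap.proj p.1.1).comp (LinearMap.fst ℚ (V → ℚ) (ι → ℚ)) -
          (LinearMap.proj p.1.2).comp (LinearMap.snd ℚ (V → ℚ) (ι → ℚ)))
      ((LinearMap.proj v₀).comp (LinearMap.fst ℚ (V → ℚ) (ι → ℚ)))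
  have hL : Function.Injective L := by
    rw [← LinearMap.ker_eq_bot, LinearMap.ker_eq_bot']
    rintro ⟨g, k⟩ hgk
    obtain ⟨h1, h2⟩ := Prod.ext_iff.1 hgk
    have h1' : ∀ p ∈ R, g p.1 = k p.2 := fun p hp => by
      have := congrFun h1 ⟨p, hp⟩
      exact sub_eq_zero.1 this
    have h2' : g v₀ = 0 := h2
    obtain ⟨q, hq1, hq2⟩ := h (fun v => g v = 0) (fun j => k j = 0) fun p hp => by
      rw [h1' p hp]
    have hq : q := (hq1 v₀ (mem_univ _)).1 h2'
    refine Prod.ext (funext fun v => (hq1 v (mem_univ _)).2 hq)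
      (funext fun j => (hq2 j (mem_univ _)).2 hq)
  have := LinearMap.finrank_le_finrank_of_injective hL
  simpa using this

variable [DecidableEq V]

/-- The incidence graph of an indexed family of edges. -/
def incidences (f : ι → Finset V) : Finset (V × ι) := {p | p.1 ∈ f p.2}

theorem mem_incidences {f : ι → Finset V} {p : V × ι} : p ∈ incidences f ↔ p.1 ∈ f p.2 := by
  simp [incidences]

theorem card_incidences_filter_snd [DecidableEq ι] (f : ι → Finset V) (j : ι) :
    #{p ∈ incidences f | p.2 = j} = #(f j) := by
  rw [← Finset.card_map (⟨fun v => (v, j), Prod.mk_left_injective j⟩ : V ↪ V × ι)]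
  congr 1
  ext ⟨v, k⟩
  simp only [mem_filter, mem_incidences, mem_map, Function.Embedding.coeFn_mk, Prod.mk.injEq]
  constructor
  · rintro ⟨h, rfl⟩
    exact ⟨v, h, rfl, rfl⟩
  · rintro ⟨w, h, rfl, rfl⟩
    exact ⟨h, rfl⟩

theorem card_incidences_filter_fst {f : ι → Finset V} (hf : Function.Injective f) (v : V) :
    #{p ∈ incidences f | p.1 = v} = hdegree (univ.image f) v := by
  unfold hdegree
  refine Finset.card_bij (fun p _ => f p.2) ?_ ?_ ?_
  · rintro ⟨w, j⟩ hp
    simp only [mem_filter, mem_incidences] at hp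
    obtain ⟨hp, rfl⟩ := hp
    simp [hp]
  · rintro ⟨w, j⟩ hp ⟨w', j'⟩ hp' h
    simp only [mem_filter] at hp hp'
    exact Prod.ext (hp.2.trans hp'.2.symm) (hf h)
  · intro e he
    simp only [mem_filter, mem_image, mem_univ, true_and] at he
    obtain ⟨⟨j, rfl⟩, hv⟩ := he
    exact ⟨(v, j), by simp [mem_incidences, hv], rfl⟩

/-- A connected bipartite graph with `|V| - 1` edges has only bridges. -/
theorem IncConnected.exists_coloring_of_card [Nonempty V] [DecidableEq ι] {R : Finset (V × ι)}
    (h : IncConnected univ univ R) (hR : #R + 1 = Fintype.card V + Fintype.card ι)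
    {v : V} {j : ι} (hp : (v, j) ∈ R) :
    ∃ (c : V → Prop) (d : ι → Prop), (∀ p ∈ R, p ≠ (v, j) → (c p.1 ↔ d p.2)) ∧
      ¬(c v ↔ d j) := by
  by_contra! hcon
  have hconn : IncConnected univ univ (R.erase (v, j)) := by
    intro c d hcd
    have hcd' : ∀ p ∈ R, p ≠ (v, j) → (c p.1 ↔ d p.2) :=
      fun p hp hne => hcd p (mem_erase.2 ⟨hne, hp⟩)
    refine h c d fun p hp => ?_
    by_cases hpe : p = (v, j)
    · subst hpe
      exact hcon c d hcd'
    · exact hcd' p hp hpe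
  have h1 := hconn.card_le
  have h2 := card_erase_add_one hp
  omega

theorem IncConnected.card_inter_le_one [Nonempty V] {f : ι → Finset V}
    (h : IncConnected univ univ (incidences f))
    (hR : #(incidences f) + 1 = Fintype.card V + Fintype.card ι) {j k : ι} (hjk : j ≠ k) :
    #(f j ∩ f k) ≤ 1 := by
  classical
  by_contra! hlt
  obtain ⟨v, hv, w, hw, hvw⟩ := one_lt_card.1 hlt
  rw [mem_inter] at hv hw
  obtain ⟨c, d, hcd, hne⟩ := h.exists_coloring_of_card hR (mem_incidences (p := (v, j)).2 hv.1)
  have h1 := hcd (v, k) (mem_incidences.2 hv.2) (by simp [hjk.symm])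
  have h2 := hcd (w, k) (mem_incidences.2 hw.2) (by simp [hjk.symm])
  have h3 := hcd (w, j) (mem_incidences.2 hw.1) (by simp [hvw.symm])
  exact hne (h1.trans (h2.symm.trans h3))

theorem IncConnected.not_hasLongCycle [Nonempty V] {f : ι → Finset V}
    (h : IncConnected univ univ (incidences f))
    (hR : #(incidences f) + 1 = Fintype.card V + Fintype.card ι) :
    ¬ HasLongCycle (univ.image f) := by
  classical
  rintro ⟨ℓ, es, vs, hes, hvs, hmem, hinc⟩
  have hex : ∀ i, ∃ j, f j = es i := fun i => by simpa using hmem i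
  choose js hjs using hex
  have hjs_inj : ∀ {i k}, js i = js k → i = k := fun {i k} hik => hes (by rw [← hjs, ← hjs, hik])
  have hin : ∀ i, (vs i, js i) ∈ incidences f := fun i => by
    simpa [mem_incidences, hjs] using (hinc i).1
  have hin' : ∀ i, (vs i, js (i + 1)) ∈ incidences f := fun i => by
    simpa [mem_incidences, hjs] using (hinc i).2
  obtain ⟨c, d, hcd, hne⟩ := h.exists_coloring_of_card hR (hin 0)
  have key : ∀ i, c (vs i) ↔ c (vs 0) := by
    intro i
    induction i using Fin.induction with
    | zero => rfl
    | succ i ih =>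
      have hsucc : i.castSucc + 1 = i.succ := Fin.coeSucc_eq_succ
      have hj : js i.succ ≠ js 0 := fun h => Fin.succ_ne_zero i (hjs_inj h)
      have h1 := hcd _ (hin i.succ) (by simp [hj])
      have h2 := hcd _ (hsucc ▸ hin' i.castSucc) (by simp [hj])
      exact h1.trans (h2.symm.trans ih)
  have hlast := hcd _ (Fin.last_add_one (ℓ + 2) ▸ hin' (Fin.last (ℓ + 2))) (by
    intro heq
    have := hvs (Prod.ext_iff.1 heq).1
    exact absurd this (Fin.last_pos).ne')
  exact hne ((key (Fin.last (ℓ + 2))).symm.trans hlast)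

theorem BergeConnected.incConnected [Nonempty V] {f : ι → Finset V}
    (hne : ∀ j, (f j).Nonempty) (h : BergeConnected (univ.image f)) :
    IncConnected univ univ (incidences f) := by
  intro c d hcd
  have hcd' : ∀ j, ∀ v ∈ f j, (c v ↔ d j) := fun j v hv => hcd (v, j) (mem_incidences.2 hv)
  have hedge : ∀ e ∈ univ.image f, ∀ v ∈ e, ∀ w ∈ e, (c v ↔ c w) := by
    intro e he v hv w hw
    obtain ⟨j, -, rfl⟩ := mem_image.1 he
    exact (hcd' j v hv).trans (hcd' j w hw).symm
  have hV : ∀ u v, c u ↔ c v := by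
    intro u v
    by_cases huv : u = v
    · rw [huv]
    obtain ⟨ℓ, vs, es, -, -, hes, rfl, rfl, hinc⟩ := h u v huv
    have key : ∀ i, c (vs 0) ↔ c (vs i) := by
      intro i
      induction i using Fin.induction with
      | zero => rfl
      | succ i ih => exact ih.trans (hedge _ (hes i) _ (hinc i).1 _ (hinc i).2)
    exact key _
  obtain ⟨v₀⟩ := ‹Nonempty V›
  refine ⟨c v₀, fun v _ => hV v v₀, fun j _ => ?_⟩
  obtain ⟨w, hw⟩ := hne j
  exact (hcd' j w hw).symm.trans (hV w v₀)

/-- The graph joining two vertices when some edge of the family contains both. -/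
def twoSection (f : ι → Finset V) : SimpleGraph V where
  Adj u v := u ≠ v ∧ ∃ j, u ∈ f j ∧ v ∈ f j
  symm := ⟨fun _ _ h => ⟨h.1.symm, h.2.imp fun _ h => h.symm⟩⟩
  loopless := ⟨fun _ h => h.1 rfl⟩

theorem IncConnected.reachable_twoSection {f : ι → Finset V}
    (h : IncConnected univ univ (incidences f)) (u v : V) : (twoSection f).Reachable u v := by
  obtain ⟨q, hq, -⟩ := h ((twoSection f).Reachable u)
    (fun j => ∃ w ∈ f j, (twoSection f).Reachable u w) (by
      rintro ⟨v, j⟩ hp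
      rw [mem_incidences] at hp
      refine ⟨fun hv => ⟨v, hp, hv⟩, ?_⟩
      rintro ⟨w, hw, huw⟩
      by_cases hvw : w = v
      · rwa [← hvw]
      · have hadj : (twoSection f).Adj w v := ⟨hvw, j, hw, hp⟩
        exact huw.trans hadj.reachable)
  exact (hq v (mem_univ _)).2 ((hq u (mem_univ _)).1 (SimpleGraph.Reachable.refl u))

theorem IncConnected.bergeConnected {f : ι → Finset V}
    (h : IncConnected univ univ (incidences f)) : BergeConnected (univ.image f) := by
  intro u v _
  obtain ⟨p, hp⟩ := (h.reachable_twoSection u v).exists_walk_length_eq_dist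
  have hdist : ∀ i ≤ p.length, (twoSection f).dist u (p.getVert i) = i := by
    intro i hi
    apply le_antisymm
    · refine (SimpleGraph.dist_le (p.take i)).trans ?_
      rw [SimpleGraph.Walk.take_length]
      exact min_le_left _ _
    · have h1 := SimpleGraph.dist_le (p.drop i)
      rw [SimpleGraph.Walk.drop_length] at h1
      have h2 := ((h.reachable_twoSection u (p.getVert i))).dist_triangle_left v
      omega
  have hadj : ∀ i : Fin p.length, (twoSection f).Adj (p.getVert i) (p.getVert (i + 1)) :=
    fun i => p.adj_getVert_succ i.2
  choose js hjs using fun i => (hadj i).2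
  refine ⟨p.length, fun i => p.getVert i, fun i => f (js i), ?_, ?_, ?_, ?_, ?_, ?_⟩
  · intro i k hik
    dsimp only at hik
    have h1 := hdist i (by omega)
    have h2 := hdist k (by omega)
    rw [hik, h2] at h1
    exact Fin.ext h1.symm
  · have hlt : ∀ i k : Fin p.length, i < k → f (js i) ≠ f (js k) := by
      intro i k hik heq
      have h1 := hdist i i.2.le
      have h2 := hdist (k + 1) k.2
      have hik' : (i : ℕ) < k := hik
      have hk : p.getVert (k + 1) ∈ f (js i) := heq ▸ (hjs k).2
      by_cases hEq : p.getVert i = p.getVert (k + 1)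
      · rw [hEq, h2] at h1
        omega
      · have hA : (twoSection f).Adj (p.getVert i) (p.getVert (k + 1)) :=
          ⟨hEq, js i, (hjs i).1, hk⟩
        have h3 := (h.reachable_twoSection u (p.getVert i)).dist_triangle_left (p.getVert (k + 1))
        rw [SimpleGraph.dist_eq_one_iff_adj.2 hA] at h3
        omega
    intro i k hik
    by_contra hne
    rcases lt_or_gt_of_ne hne with h' | h'
    · exact hlt i k h' hik
    · exact hlt k i h' hik.symm
  · intro i
    simp
  · simp
  · simp
  · intro i
    simpa using hjs i

end Incidences

/-- Labelling the edges of a hypertree with given degrees gives all connected bipartite graphs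
with the corresponding degrees. -/
theorem card_connBip_eq_mul_factorial {n r t : ℕ} [NeZero n] (hr : 2 ≤ r)
    (hrt : r * t + 1 = n + t) (x : Fin n → ℕ) (hsum : ∑ i, x i = r * t) :
    #(connBip (univ : Finset (Fin n)) (univ : Finset (Fin t)) x fun _ => r) =
      Nat.card {E : Finset (Finset (Fin n)) //
        IsHypertree E ∧ UniformR r E ∧ ∀ i, hdegree E i = x i} * t.factorial := by
  classical
  have hcardE : ∀ E : Finset (Finset (Fin n)), UniformR r E → (∀ i, hdegree E i = x i) →
      #E = t := by
    intro E hU hd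
    have h1 : ∑ i, hdegree E i = ∑ e ∈ E, #e := by
      have := Finset.sum_card_bipartiteAbove_eq_sum_card_bipartiteBelow
        (s := (univ : Finset (Fin n))) (t := E) (fun i e => i ∈ e)
      simpa [Finset.bipartiteAbove, Finset.bipartiteBelow, hdegree] using this
    rw [Finset.sum_congr rfl fun i _ => hd i, hsum, Finset.sum_congr rfl hU, Finset.sum_const,
      smul_eq_mul, mul_comm] at h1
    exact (Nat.eq_of_mul_eq_mul_right (by omega) h1).symm
  have himage : ∀ {E : Finset (Finset (Fin n))} (σ : Fin t ≃ E),
      univ.image (fun j => (σ j).1) = E := by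
    intro E σ
    ext e
    simp only [mem_image, mem_univ, true_and]
    exact ⟨by rintro ⟨j, rfl⟩; exact (σ j).2, fun he => ⟨σ.symm ⟨e, he⟩, by simp⟩⟩
  have hcardR : ∀ f : Fin t → Finset (Fin n), (∀ j, #(f j) = r) →
      #(incidences f) + 1 = Fintype.card (Fin n) + Fintype.card (Fin t) := by
    intro f hf
    have h1 := Finset.card_eq_sum_card_fiberwise (f := Prod.snd) (s := incidences f)
      (t := (univ : Finset (Fin t))) (by simp [Set.MapsTo])
    simp only [card_incidences_filter_snd, hf, sum_const, card_univ, Fintype.card_fin,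
      smul_eq_mul] at h1
    rw [h1, mul_comm, hrt, Fintype.card_fin, Fintype.card_fin]
  have hmem : ∀ E : Finset (Finset (Fin n)), IsHypertree E → UniformR r E →
      (∀ i, hdegree E i = x i) → ∀ σ : Fin t ≃ E, (incidences fun j => (σ j).1) ∈
        connBip (univ : Finset (Fin n)) (univ : Finset (Fin t)) x fun _ => r := by
    intro E hT hU hd σ
    have hf : Function.Injective fun j => (σ j).1 := Subtype.val_injective.comp σ.injective
    have hcard : ∀ j, #(σ j).1 = r := fun j => hU _ (σ j).2
    refine mem_connBip.2 ⟨by simp, ?_, ?_, ?_⟩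
    · refine BergeConnected.incConnected (fun j => card_pos.1 ?_) ?_
      · rw [hcard]
        omega
      · rw [himage]
        exact hT.1
    · intro i _
      refine Eq.trans ?_ ((card_incidences_filter_fst hf i).trans (by rw [himage, hd]))
      congr!
    · intro j _
      rw [← hcard j, ← card_incidences_filter_snd (fun j => (σ j).1) j]
      congr!
  let F : (Σ E : {E : Finset (Finset (Fin n)) //
        IsHypertree E ∧ UniformR r E ∧ ∀ i, hdegree E i = x i}, (Fin t ≃ E.1)) →
      {R // R ∈ connBip (univ : Finset (Fin n)) (univ : Finset (Fin t)) x fun _ => r} :=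
    fun s => ⟨incidences fun j => (s.2 j).1,
      hmem s.1.1 s.1.2.1 s.1.2.2.1 s.1.2.2.2 s.2⟩
  have hF : Function.Bijective F := by
    constructor
    · rintro ⟨⟨E, hE⟩, σ⟩ ⟨⟨E', hE'⟩, σ'⟩ h
      change Fin t ≃ E at σ
      change Fin t ≃ E' at σ'
      have hR := Subtype.ext_iff.1 h
      have hσ : ∀ j, (σ j).1 = (σ' j).1 := by
        intro j
        ext i
        have := Finset.ext_iff.1 hR (i, j)
        simpa [F, mem_incidences] using this
      have hEE : E = E' := by
        rw [← himage σ, ← himage σ']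
        simp only [hσ]
      subst hEE
      have : σ = σ' := Equiv.ext fun j => Subtype.ext (hσ j)
      rw [this]
    · rintro ⟨R, hR⟩
      obtain ⟨-, h2, h3, h4⟩ := mem_connBip.1 hR
      let f : Fin t → Finset (Fin n) := fun j => {i | (i, j) ∈ R}
      have hRf : incidences f = R := by
        ext ⟨i, j⟩
        simp [mem_incidences, f]
      have hcard : ∀ j, #(f j) = r := by
        intro j
        rw [← h4 j (mem_univ _), ← card_incidences_filter_snd f j, hRf]
        congr!
      rw [← hRf] at h2
      have hint := fun {j k} => h2.card_inter_le_one (hcardR f hcard) (j := j) (k := k)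
      have hf : Function.Injective f := by
        intro j k hjk
        by_contra hne
        have h1 := hint hne
        rw [← hjk, inter_self, hcard] at h1
        omega
      have hsurj : Function.Bijective
          (fun j => ⟨f j, mem_image_of_mem f (mem_univ j)⟩ : Fin t → (univ.image f : Finset _)) := by
        refine ⟨fun j k h => hf (Subtype.ext_iff.1 h), ?_⟩
        rintro ⟨e, he⟩
        obtain ⟨j, -, rfl⟩ := mem_image.1 he
        exact ⟨j, rfl⟩
      refine ⟨⟨⟨univ.image f, ⟨h2.bergeConnected, ?_, h2.not_hasLongCycle (hcardR f hcard)⟩,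
        ?_, ?_⟩, Equiv.ofBijective _ hsurj⟩, Subtype.ext hRf⟩
      · rintro ⟨e, he, e', he', hne, hle⟩
        obtain ⟨j, -, rfl⟩ := mem_image.1 he
        obtain ⟨k, -, rfl⟩ := mem_image.1 he'
        have := hint (j := j) (k := k) fun h => hne (by rw [h])
        omega
      · intro e he
        obtain ⟨j, -, rfl⟩ := mem_image.1 he
        exact hcard j
      · intro i
        rw [← card_incidences_filter_fst hf i, hRf, ← h3 i (mem_univ _)]
        congr!
  rw [← Fintype.card_coe, ← Nat.card_eq_fintype_card, ← Nat.card_eq_of_bijective F hF,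
    Nat.card_sigma, Finset.sum_congr rfl fun E _ => by
      rw [Nat.card_eq_fintype_card, Fintype.card_equiv (Fintype.equivFinOfCardEq
        ((Fintype.card_coe _).trans (hcardE E.1 E.2.2.1 E.2.2.2))).symm, Fintype.card_fin],
    Finset.sum_const, card_univ, smul_eq_mul, Nat.card_eq_fintype_card]

/-- Bacher's formula: the number of `r`-uniform hypertrees on `[n]` with
degree sequence `x` equals `(r-1)·(n-2)! / (((r-1)!)^t · ∏ (xᵢ-1)!)`
(stated multiplied out). -/
theorem count_hypertrees_with_degree_sequence {n r t : ℕ} (hn : 2 ≤ n)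
    (hr : 2 ≤ r) (ht : t * (r - 1) = n - 1) (x : Fin n → ℕ)
    (hx : ∀ i, 1 ≤ x i) (hsum : ∑ i, x i = r * t) :
    Nat.card {E : Finset (Finset (Fin n)) //
        IsHypertree E ∧ UniformR r E ∧ ∀ i, hdegree E i = x i} *
      (((r - 1).factorial) ^ t * ∏ i, (x i - 1).factorial) =
    (r - 1) * (n - 2).factorial := by
  classical
  have : NeZero n := ⟨by omega⟩
  have ht0 : 0 < t := by
    rcases Nat.eq_zero_or_pos t with rfl | h
    · omega
    · exact h
  have hrt : r * t + 1 = n + t := by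
    obtain ⟨s, rfl⟩ : ∃ s, r = s + 1 := ⟨r - 1, by omega⟩
    rw [Nat.add_sub_cancel] at ht
    rw [add_mul, mul_comm s t, ht]
    omega
  have : NeZero t := ⟨by omega⟩
  have hmain := card_connBip_mul (A := (univ : Finset (Fin n))) (B := (univ : Finset (Fin t)))
    (x := x) (y := fun _ => r) univ_nonempty univ_nonempty (fun i _ => hx i)
    (fun _ _ => by omega) (by simpa [hsum] using hrt) (by simpa [mul_comm t r] using hrt)
  have hcount := card_connBip_eq_mul_factorial hr hrt x hsum
  rw [hcount] at hmain
  simp only [prod_const, card_univ, Fintype.card_fin] at hmain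
  have hfac : t.factorial = t * (t - 1).factorial := (Nat.mul_factorial_pred (by omega)).symm
  have hfac' : (n - 1).factorial = t * (r - 1) * (n - 2).factorial := by
    rw [ht, ← Nat.mul_factorial_pred (n := n - 1) (by omega), Nat.sub_sub]
  rw [hfac, hfac'] at hmain
  refine Nat.eq_of_mul_eq_mul_left (Nat.mul_pos ht0 (Nat.factorial_pos (t - 1))) ?_
  linarith
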